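/- Let n ≥ 1, γ > 1, and g(x) := e^{|x|/log^γ(e+|x|)} for x ∈ ℝ^n. Then for every r ≥ 1 and every β ∈ (0,1): S_g(r) ≤ r^{2(β−1)}/π + (log 2)/(π log^γ(e + r^β)) + (2/π)(1 + e/r)(γ−1)^{−1} log^{1−γ}(e+r). -/

import Mathlib

open MeasureTheory

/-- `S_{g,x}(r) := (1/π) ∫_{−∞}^∞ log g(τx)/(τ² + max{r,1}²) dτ`. -/
noncomputable def Sfun (n : ℕ) (g : EuclideanSpace ℝ (Fin n) → ℝ)
    (x : EuclideanSpace ℝ (Fin n)) (r : ℝ) : ℝ :=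
  Real.pi⁻¹ * ∫ τ : ℝ, Real.log (g (τ • x)) / (τ ^ 2 + (max r 1) ^ 2)

/-- `S_g(r) := sup_{x ∈ S^{n−1}} S_{g,x}(r)`. -/
noncomputable def Ssup (n : ℕ) (g : EuclideanSpace ℝ (Fin n) → ℝ) (r : ℝ) : ℝ :=
  ⨆ x : Metric.sphere (0 : EuclideanSpace ℝ (Fin n)) 1, Sfun n g (x : EuclideanSpace ℝ (Fin n)) r

lemma one_le_log_exp_one_add {t : ℝ} (ht : 0 ≤ t) : 1 ≤ Real.log (Real.exp 1 + t) := by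
  rw [Real.le_log_iff_exp_le (by positivity)]
  linarith

lemma hasDerivAt_log_exp_one_add_rpow {γ t : ℝ} (hγ : 1 < γ) (ht : 0 ≤ t) :
    HasDerivAt (fun t => -((γ - 1)⁻¹ * Real.log (Real.exp 1 + t) ^ (1 - γ)))
      (1 / ((Real.exp 1 + t) * Real.log (Real.exp 1 + t) ^ γ)) t := by
  have hL := one_le_log_exp_one_add ht
  have hpos : 0 < Real.exp 1 + t := by positivity
  have h := ((((hasDerivAt_id t).const_add (Real.exp 1)).log hpos.ne').rpow_const
    (p := 1 - γ) (Or.inl (by simp only [id]; linarith))).const_mul (γ - 1)⁻¹ |>.neg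
  refine h.congr_deriv ?_
  simp only [id]
  rw [show 1 - γ - 1 = -γ by ring, Real.rpow_neg (by linarith)]
  have : 0 < Real.log (Real.exp 1 + t) ^ γ := Real.rpow_pos_of_pos (by linarith) _
  have : γ - 1 ≠ 0 := by linarith
  field_simp
  ring

lemma tendsto_log_exp_one_add_rpow {γ : ℝ} (hγ : 1 < γ) :
    Filter.Tendsto (fun t => -((γ - 1)⁻¹ * Real.log (Real.exp 1 + t) ^ (1 - γ)))
      Filter.atTop (nhds 0) := by
  have h := ((tendsto_rpow_neg_atTop (y := γ - 1) (by linarith)).comp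
    (Real.tendsto_log_atTop.comp
      (Filter.tendsto_atTop_add_const_left _ (Real.exp 1) Filter.tendsto_id))).const_mul
        (γ - 1)⁻¹ |>.neg
  simpa [Function.comp_def] using h

lemma integrableOn_Ioi_inv_mul_log_rpow {γ r : ℝ} (hγ : 1 < γ) (hr : 0 ≤ r) :
    IntegrableOn (fun t => 1 / ((Real.exp 1 + t) * Real.log (Real.exp 1 + t) ^ γ))
      (Set.Ioi r) := by
  refine integrableOn_Ioi_deriv_of_nonneg'
    (fun t ht => hasDerivAt_log_exp_one_add_rpow hγ (hr.trans ht)) (fun t ht => ?_)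
    (tendsto_log_exp_one_add_rpow hγ)
  have ht0 : 0 ≤ t := hr.trans (le_of_lt ht)
  have := one_le_log_exp_one_add ht0
  positivity

lemma integral_Ioi_inv_mul_log_rpow {γ r : ℝ} (hγ : 1 < γ) (hr : 0 ≤ r) :
    ∫ t in Set.Ioi r, 1 / ((Real.exp 1 + t) * Real.log (Real.exp 1 + t) ^ γ)
      = (γ - 1)⁻¹ * Real.log (Real.exp 1 + r) ^ (1 - γ) := by
  rw [integral_Ioi_of_hasDerivAt_of_tendsto'
    (fun t ht => hasDerivAt_log_exp_one_add_rpow hγ (hr.trans ht))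
    (integrableOn_Ioi_inv_mul_log_rpow hγ hr) (tendsto_log_exp_one_add_rpow hγ)]
  ring

lemma continuousOn_div_log_rpow_div (γ : ℝ) {r : ℝ} (hr : 0 < r) :
    ContinuousOn (fun t => t / Real.log (Real.exp 1 + t) ^ γ / (t ^ 2 + r ^ 2)) (Set.Ici 0) := by
  have hL : ∀ t ∈ Set.Ici (0 : ℝ), Real.log (Real.exp 1 + t) ≠ 0 := fun t ht => by
    have := one_le_log_exp_one_add ht
    linarith
  have hc : ContinuousOn (fun t => Real.log (Real.exp 1 + t)) (Set.Ici 0) :=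
    ContinuousOn.log (by fun_prop) fun t (ht : 0 ≤ t) => by positivity
  refine (continuousOn_id.div (hc.rpow_const fun t ht => Or.inl (hL t ht))
    fun t ht => ?_).div (by fun_prop) fun t _ => by positivity
  have := one_le_log_exp_one_add ht
  positivity

lemma div_log_rpow_div_le_tail {γ r t : ℝ} (hr : 0 < r) (ht : r < t) :
    t / Real.log (Real.exp 1 + t) ^ γ / (t ^ 2 + r ^ 2)
      ≤ (1 + Real.exp 1 / r) * (1 / ((Real.exp 1 + t) * Real.log (Real.exp 1 + t) ^ γ)) := by
  have ht0 : 0 < t := hr.trans ht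
  have hL := one_le_log_exp_one_add ht0.le
  have hLγ : 0 < Real.log (Real.exp 1 + t) ^ γ := Real.rpow_pos_of_pos (by linarith) _
  have he := Real.exp_pos 1
  have key : t / (t ^ 2 + r ^ 2) ≤ (1 + Real.exp 1 / r) / (Real.exp 1 + t) := by
    calc t / (t ^ 2 + r ^ 2) ≤ t / t ^ 2 := by gcongr; nlinarith
      _ = (1 + Real.exp 1 / t) / (Real.exp 1 + t) := by field_simp; ring
      _ ≤ (1 + Real.exp 1 / r) / (Real.exp 1 + t) := by gcongr
  calc t / Real.log (Real.exp 1 + t) ^ γ / (t ^ 2 + r ^ 2)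
      = t / (t ^ 2 + r ^ 2) / Real.log (Real.exp 1 + t) ^ γ := div_right_comm _ _ _
    _ ≤ (1 + Real.exp 1 / r) / (Real.exp 1 + t) / Real.log (Real.exp 1 + t) ^ γ := by gcongr
    _ = _ := by rw [div_div, mul_one_div]

lemma integrableOn_Ioi_div_log_rpow_div {γ r : ℝ} (hγ : 1 < γ) (hr : 0 < r) :
    IntegrableOn (fun t => t / Real.log (Real.exp 1 + t) ^ γ / (t ^ 2 + r ^ 2)) (Set.Ioi r) := by
  refine ((integrableOn_Ioi_inv_mul_log_rpow hγ hr.le).const_mul (1 + Real.exp 1 / r)).mono'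
    (((continuousOn_div_log_rpow_div γ hr).mono
      (Set.Ioi_subset_Ici hr.le)).aestronglyMeasurable measurableSet_Ioi) ?_
  refine (ae_restrict_mem measurableSet_Ioi).mono fun t ht => ?_
  have ht0 : 0 < t := hr.trans ht
  have := one_le_log_exp_one_add ht0.le
  rw [Real.norm_of_nonneg (by positivity)]
  exact div_log_rpow_div_le_tail hr ht

lemma integral_Ioi_div_log_rpow_div_le_tail {γ r : ℝ} (hγ : 1 < γ) (hr : 0 < r) :
    ∫ t in Set.Ioi r, t / Real.log (Real.exp 1 + t) ^ γ / (t ^ 2 + r ^ 2)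
      ≤ (1 + Real.exp 1 / r) * ((γ - 1)⁻¹ * Real.log (Real.exp 1 + r) ^ (1 - γ)) := by
  rw [← integral_Ioi_inv_mul_log_rpow hγ hr.le, ← integral_const_mul]
  exact setIntegral_mono_on (integrableOn_Ioi_div_log_rpow_div hγ hr)
    ((integrableOn_Ioi_inv_mul_log_rpow hγ hr.le).const_mul _) measurableSet_Ioi
    fun t ht => div_log_rpow_div_le_tail hr ht

lemma intervalIntegrable_div_log_rpow_div (γ : ℝ) {r a b : ℝ} (hr : 0 < r) (ha : 0 ≤ a)
    (hab : a ≤ b) :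
    IntervalIntegrable (fun t => t / Real.log (Real.exp 1 + t) ^ γ / (t ^ 2 + r ^ 2))
      volume a b :=
  ((continuousOn_div_log_rpow_div γ hr).mono fun t ht => by
    rw [Set.uIcc_of_le hab] at ht
    exact ha.trans ht.1).intervalIntegrable

lemma integral_div_log_rpow_div_le_sq {γ r a : ℝ} (hγ : 0 ≤ γ) (hr : 0 < r) (ha : 0 ≤ a) :
    ∫ t in (0 : ℝ)..a, t / Real.log (Real.exp 1 + t) ^ γ / (t ^ 2 + r ^ 2)
      ≤ a ^ 2 / r ^ 2 / 2 := by
  calc _ ≤ ∫ t in (0 : ℝ)..a, t / r ^ 2 := by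
        refine intervalIntegral.integral_mono_on ha
          (intervalIntegrable_div_log_rpow_div γ hr le_rfl ha)
          (Continuous.intervalIntegrable (by fun_prop) _ _) fun t ht => ?_
        have ht0 : 0 ≤ t := ht.1
        have hLγ : 1 ≤ Real.log (Real.exp 1 + t) ^ γ :=
          Real.one_le_rpow (one_le_log_exp_one_add ht0) hγ
        have h1 := div_le_self ht0 hLγ
        gcongr
        nlinarith
    _ = _ := by
        rw [intervalIntegral.integral_div, integral_id]
        ring

lemma integral_id_div_sq_add_sq {r a : ℝ} (hr : 0 < r) :
    ∫ t in a..r, t / (t ^ 2 + r ^ 2)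
      = (Real.log (r ^ 2 + r ^ 2) - Real.log (a ^ 2 + r ^ 2)) / 2 := by
  rw [intervalIntegral.integral_eq_sub_of_hasDerivAt
    (f := fun t => Real.log (t ^ 2 + r ^ 2) / 2)]
  · ring
  · intro t _
    have h := (((hasDerivAt_pow 2 t).add_const (r ^ 2)).log (by positivity)).div_const 2
    refine h.congr_deriv ?_
    have : t ^ 2 + r ^ 2 ≠ 0 := by positivity
    field_simp
    simp [mul_comm]
  · exact (Continuous.div (by fun_prop) (by fun_prop)
      fun t => by positivity).intervalIntegrable _ _

lemma integral_div_log_rpow_div_le_log {γ r a : ℝ} (hγ : 0 ≤ γ) (hr : 0 < r) (ha : 0 ≤ a)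
    (har : a ≤ r) :
    ∫ t in a..r, t / Real.log (Real.exp 1 + t) ^ γ / (t ^ 2 + r ^ 2)
      ≤ Real.log 2 / Real.log (Real.exp 1 + a) ^ γ / 2 := by
  have hLa := one_le_log_exp_one_add ha
  calc _ ≤ ∫ t in a..r, t / (t ^ 2 + r ^ 2) / Real.log (Real.exp 1 + a) ^ γ := by
        refine intervalIntegral.integral_mono_on har
          (intervalIntegrable_div_log_rpow_div γ hr ha har)
          (Continuous.intervalIntegrable ((Continuous.div (by fun_prop) (by fun_prop)
            fun t => by positivity).div_const _) _ _) fun t ht => ?_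
        have ht0 : 0 ≤ t := ha.trans ht.1
        have hat : a ≤ t := ht.1
        rw [div_right_comm]
        gcongr
    _ = (Real.log (r ^ 2 + r ^ 2) - Real.log (a ^ 2 + r ^ 2)) / 2
          / Real.log (Real.exp 1 + a) ^ γ := by
        rw [intervalIntegral.integral_div, integral_id_div_sq_add_sq hr]
    _ ≤ Real.log 2 / 2 / Real.log (Real.exp 1 + a) ^ γ := by
        have h1 : Real.log (r ^ 2 + r ^ 2) = Real.log 2 + Real.log (r ^ 2) := by
          rw [← Real.log_mul (by norm_num) (by positivity)]
          ring_nf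
        have h2 : Real.log (r ^ 2) ≤ Real.log (a ^ 2 + r ^ 2) :=
          Real.log_le_log (by positivity) (by nlinarith)
        gcongr
        linarith
    _ = _ := div_right_comm _ _ _

lemma integral_Ioi_div_log_rpow_div_le {γ r a : ℝ} (hγ : 1 < γ) (hr : 0 < r) (ha : 0 ≤ a)
    (har : a ≤ r) :
    ∫ t in Set.Ioi (0 : ℝ), t / Real.log (Real.exp 1 + t) ^ γ / (t ^ 2 + r ^ 2)
      ≤ a ^ 2 / r ^ 2 / 2 + Real.log 2 / Real.log (Real.exp 1 + a) ^ γ / 2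
        + (1 + Real.exp 1 / r) * ((γ - 1)⁻¹ * Real.log (Real.exp 1 + r) ^ (1 - γ)) := by
  have hγ0 : 0 ≤ γ := by linarith
  have hi0 := intervalIntegrable_div_log_rpow_div γ hr le_rfl ha
  have hi1 := intervalIntegrable_div_log_rpow_div γ hr ha har
  have hi2 := integrableOn_Ioi_div_log_rpow_div hγ hr
  have h0r := (intervalIntegrable_iff_integrableOn_Ioc_of_le hr.le).1 (hi0.trans hi1)
  rw [← Set.Ioc_union_Ioi_eq_Ioi hr.le,
    setIntegral_union (Set.Ioc_disjoint_Ioi le_rfl) measurableSet_Ioi h0r hi2,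
    ← intervalIntegral.integral_of_le hr.le,
    ← intervalIntegral.integral_add_adjacent_intervals hi0 hi1]
  exact add_le_add (add_le_add (integral_div_log_rpow_div_le_sq hγ0 hr ha)
    (integral_div_log_rpow_div_le_log hγ0 hr ha har))
    (integral_Ioi_div_log_rpow_div_le_tail hγ hr)

/-- for `g(x) = e^{|x|/log^γ(e+|x|)}`, `γ > 1`, every `r ≥ 1` and `β ∈ (0,1)`,
`S_g(r) ≤ r^{2(β−1)}/π + log 2/(π log^γ(e+r^β)) + (2/π)(1+e/r)(γ−1)⁻¹ log^{1−γ}(e+r)`. -/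
theorem statement8 (n : ℕ) (hn : 1 ≤ n) (γ : ℝ) (hγ : 1 < γ)
    (g : EuclideanSpace ℝ (Fin n) → ℝ)
    (hg : g = fun x => Real.exp (‖x‖ / (Real.log (Real.exp 1 + ‖x‖)) ^ γ)) :
    ∀ r : ℝ, 1 ≤ r → ∀ β ∈ Set.Ioo (0 : ℝ) 1,
      Ssup n g r ≤ r ^ (2 * (β - 1)) / Real.pi
        + Real.log 2 / (Real.pi * (Real.log (Real.exp 1 + r ^ β)) ^ γ)
        + (2 / Real.pi) * (1 + Real.exp 1 / r) * (γ - 1)⁻¹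
          * (Real.log (Real.exp 1 + r)) ^ (1 - γ) := by
  intro r hr β hβ
  have hr0 : 0 < r := by linarith
  have : Nonempty (Fin n) := ⟨⟨0, hn⟩⟩
  have : Nonempty (Metric.sphere (0 : EuclideanSpace ℝ (Fin n)) 1) :=
    (NormedSpace.sphere_nonempty.2 zero_le_one).to_subtype
  refine ciSup_le fun x => ?_
  have hx : ‖(x : EuclideanSpace ℝ (Fin n))‖ = 1 := by simp
  have hint : ∫ τ : ℝ, Real.log (g (τ • (x : EuclideanSpace ℝ (Fin n))))
        / (τ ^ 2 + (max r 1) ^ 2)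
      = 2 * ∫ t in Set.Ioi (0 : ℝ),
          t / Real.log (Real.exp 1 + t) ^ γ / (t ^ 2 + r ^ 2) := by
    rw [← integral_comp_abs
      (f := fun t => t / Real.log (Real.exp 1 + t) ^ γ / (t ^ 2 + r ^ 2))]
    simp only [hg, Real.log_exp, norm_smul, hx, mul_one, Real.norm_eq_abs, sq_abs,
      max_eq_left hr]
  have har : r ^ β ≤ r := by
    simpa using Real.rpow_le_rpow_of_exponent_le hr hβ.2.le
  have hpow : r ^ (2 * (β - 1)) = (r ^ β) ^ 2 / r ^ 2 := by
    rw [mul_comm, Real.rpow_mul hr0.le, Real.rpow_sub_one hr0.ne', Real.rpow_two, div_pow]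
  rw [Sfun, hint, hpow]
  refine (mul_le_mul_of_nonneg_left (mul_le_mul_of_nonneg_left
    (integral_Ioi_div_log_rpow_div_le hγ hr0 (Real.rpow_nonneg hr0.le β) har) zero_le_two)
    (inv_nonneg.2 Real.pi_pos.le)).trans_eq ?_
  rw [mul_comm Real.pi (_ ^ γ), ← div_div (Real.log 2)]
  ring
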